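/- For every n ∈ (0,1], β > 0 and h ∈ ℝ: φ_N(n,β,h) ≤ α_RS(n,β,h) uniformly in N, i.e. φ_N(n,β,h) ≤ inf_{q∈[0,1]} α(n,β,h,q) for every N ≥ 1. -/

import Mathlib

open MeasureTheory ProbabilityTheory Real Filter Topology

noncomputable section

/-- The ±1 spin value attached to a Boolean. -/
def spinVal (b : Bool) : ℝ := if b then 1 else -1

/-- Law of the couplings `J = (J_{ij})`: i.i.d. standard Gaussians. -/
def skMuJ (N : ℕ) : Measure (Fin N × Fin N → ℝ) :=
  Measure.pi fun _ => gaussianReal 0 1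

/-- The Sherrington–Kirkpatrick Hamiltonian. -/
def skH (N : ℕ) (h : ℝ) (J : Fin N × Fin N → ℝ) (σ : Fin N → Bool) : ℝ :=
  -(1 / Real.sqrt (N : ℝ)) *
      ∑ p ∈ Finset.univ.filter (fun p : Fin N × Fin N => p.1 < p.2),
        J p * spinVal (σ p.1) * spinVal (σ p.2)
    - h * ∑ i, spinVal (σ i)

/-- The SK partition function. -/
def skZ (N : ℕ) (β h : ℝ) (J : Fin N × Fin N → ℝ) : ℝ :=
  ∑ σ : Fin N → Bool, Real.exp (-β * skH N h J σ)

/-- Quenched pressure `α_N(β,h) = N⁻¹ E log Z_N`. -/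
def skAlpha (N : ℕ) (β h : ℝ) : ℝ :=
  (1 / (N : ℝ)) * ∫ J, Real.log (skZ N β h J) ∂ skMuJ N

/-- Interpolating function `φ_N(n,β,h) = (Nn)⁻¹ log E[Z_N^n]`. -/
def skPhi (N : ℕ) (n β h : ℝ) : ℝ :=
  (1 / ((N : ℝ) * n)) * Real.log (∫ J, skZ N β h J ^ n ∂ skMuJ N)

/-- Replica symmetric trial function
`α(n,β,h,q) = log 2 + n⁻¹ log ∫ cosh^n(β(√q z + h)) dμ(z) + (β²/4)(1 - 2q - (n-1)q²)`. -/
def rsTrial (n β h q : ℝ) : ℝ :=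
  Real.log 2 +
    (1 / n) * Real.log (∫ z, Real.cosh (β * (Real.sqrt q * z + h)) ^ n ∂ gaussianReal 0 1) +
    β ^ 2 / 4 * (1 - 2 * q - (n - 1) * q ^ 2)

/-- `α_RS(n,β,h) = inf_{q ∈ [0,1]} α(n,β,h,q)`. -/
def alphaRS (n β h : ℝ) : ℝ := ⨅ q : Set.Icc (0:ℝ) 1, rsTrial n β h q

/-- A family of functions of a finite real vector which grows at most exponentially,
uniformly in the parameter. -/
def HasExpGrowth {Θ K : Type*} [Fintype K] (f : Θ → (K → ℝ) → ℝ) : Prop :=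
  ∃ C B : ℝ, 0 ≤ C ∧ 0 ≤ B ∧ ∀ θ g, |f θ g| ≤ C * Real.exp (B * ∑ k, |g k|)

namespace HasExpGrowth

variable {Θ K : Type*} [Fintype K] {f f' : Θ → (K → ℝ) → ℝ}

lemma mul (hf : HasExpGrowth f) (hf' : HasExpGrowth f') :
    HasExpGrowth fun θ g => f θ g * f' θ g := by
  obtain ⟨C, B, hC, hB, h⟩ := hf
  obtain ⟨C', B', hC', hB', h'⟩ := hf'
  refine ⟨C * C', B + B', by positivity, by positivity, fun θ g => ?_⟩
  rw [abs_mul, add_mul, Real.exp_add, mul_mul_mul_comm]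
  exact mul_le_mul (h θ g) (h' θ g) (abs_nonneg _) (by positivity)

lemma add (hf : HasExpGrowth f) (hf' : HasExpGrowth f') :
    HasExpGrowth fun θ g => f θ g + f' θ g := by
  obtain ⟨C, B, hC, hB, h⟩ := hf
  obtain ⟨C', B', hC', hB', h'⟩ := hf'
  refine ⟨C + C', B + B', by positivity, by positivity, fun θ g => ?_⟩
  have hS : 0 ≤ ∑ k, |g k| := Finset.sum_nonneg fun _ _ => abs_nonneg _
  have h₁ : Real.exp (B * ∑ k, |g k|) ≤ Real.exp ((B + B') * ∑ k, |g k|) :=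
    Real.exp_le_exp.2 (mul_le_mul_of_nonneg_right (by linarith) hS)
  have h₂ : Real.exp (B' * ∑ k, |g k|) ≤ Real.exp ((B + B') * ∑ k, |g k|) :=
    Real.exp_le_exp.2 (mul_le_mul_of_nonneg_right (by linarith) hS)
  calc |f θ g + f' θ g| ≤ |f θ g| + |f' θ g| := abs_add_le _ _
    _ ≤ C * Real.exp (B * ∑ k, |g k|) + C' * Real.exp (B' * ∑ k, |g k|) :=
      add_le_add (h θ g) (h' θ g)
    _ ≤ C * Real.exp ((B + B') * ∑ k, |g k|) + C' * Real.exp ((B + B') * ∑ k, |g k|) := by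
      gcongr
    _ = _ := by ring

lemma of_bounded {c : Θ → ℝ} {A : ℝ} (hc : ∀ θ, |c θ| ≤ A) :
    HasExpGrowth fun θ (_ : K → ℝ) => c θ :=
  ⟨|A|, 0, abs_nonneg _, le_rfl, fun θ g => by simpa using (hc θ).trans (le_abs_self A)⟩

lemma const (c : ℝ) : HasExpGrowth fun (_ : Θ) (_ : K → ℝ) => c :=
  of_bounded (A := |c|) fun _ => le_rfl

lemma sum {ι : Type*} (s : Finset ι) {F : ι → Θ → (K → ℝ) → ℝ}
    (hF : ∀ i, HasExpGrowth (F i)) : HasExpGrowth fun θ g => ∑ i ∈ s, F i θ g := by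
  classical
  induction s using Finset.induction_on with
  | empty => simpa using const 0
  | insert i s hi ih => simpa [Finset.sum_insert hi] using (hF i).add ih

lemma coord (k : K) : HasExpGrowth fun (_ : Θ) (g : K → ℝ) => g k := by
  refine ⟨1, 1, zero_le_one, zero_le_one, fun _ g => ?_⟩
  have h₁ : |g k| ≤ ∑ k, |g k| :=
    Finset.single_le_sum (f := fun k => |g k|) (fun _ _ => abs_nonneg _) (Finset.mem_univ k)
  have h₂ := Real.add_one_le_exp (∑ k, |g k|)
  rw [one_mul, one_mul]
  linarith

/-- Functions of at most exponential growth are integrable for the standard Gaussian. -/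
lemma integrable (hf : HasExpGrowth f) (hc : ∀ θ, Continuous (f θ)) (θ : Θ) :
    Integrable (f θ) (Measure.pi fun _ : K => gaussianReal 0 1) := by
  obtain ⟨C, B, -, -, h⟩ := hf
  refine Integrable.mono' (g := fun g => C * Real.exp (B * ∑ k, |g k|)) ?_
    (hc θ).aestronglyMeasurable (ae_of_all _ fun g => h θ g)
  refine Integrable.const_mul ?_ C
  simp_rw [Finset.mul_sum, Real.exp_sum]
  exact Integrable.fintype_prod (f := fun _ x => Real.exp (B * |x|)) fun _ =>
    integrable_exp_mul_abs (X := fun x => x) (integrable_exp_mul_gaussianReal B)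
      (integrable_exp_mul_gaussianReal (-B))

end HasExpGrowth

/-- Gaussian integration by parts on the real line. -/
lemma integral_mul_gaussianReal_eq_integral_deriv {f f' : ℝ → ℝ}
    (hd : ∀ x, HasDerivAt f (f' x) x) (hf : Integrable f (gaussianReal 0 1))
    (hxf : Integrable (fun x => x * f x) (gaussianReal 0 1))
    (hf' : Integrable f' (gaussianReal 0 1)) :
    ∫ x, x * f x ∂gaussianReal 0 1 = ∫ x, f' x ∂gaussianReal 0 1 := by
  have hI : ∀ F : ℝ → ℝ, Integrable F (gaussianReal 0 1) →
      Integrable (fun x => gaussianPDFReal 0 1 x * F x) := by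
    intro F hF
    rw [gaussianReal_of_var_ne_zero 0 one_ne_zero,
      integrable_withDensity_iff_integrable_smul' (measurable_gaussianPDF 0 1)
        (ae_of_all _ fun _ => gaussianPDF_lt_top)] at hF
    simpa [toReal_gaussianPDF] using hF
  have hp : ∀ x, HasDerivAt (gaussianPDFReal 0 1) (-(x * gaussianPDFReal 0 1 x)) x := by
    intro x
    have h₁ : HasDerivAt (fun y : ℝ => -(y - 0) ^ 2 / (2 * ((1 : NNReal) : ℝ))) (-x) x := by
      have := ((((hasDerivAt_id x).sub_const 0).pow 2).neg).div_const (2 * ((1 : NNReal) : ℝ))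
      convert! this using 1
      simp
      ring
    have := (h₁.exp).const_mul (√(2 * π * ((1 : NNReal) : ℝ)))⁻¹
    rw [gaussianPDFReal_def]
    convert! this using 1
    ring
  have key := integral_mul_deriv_eq_deriv_mul_of_integrable
    (u := gaussianPDFReal 0 1) (v := f) (fun x _ => hp x) (fun x _ => hd x) (hI f' hf')
    (by convert! (hI _ hxf).neg using 1; ext x; simp; ring) (hI f hf)
  rw [integral_gaussianReal_eq_integral_smul one_ne_zero,
    integral_gaussianReal_eq_integral_smul one_ne_zero]
  simp only [smul_eq_mul]
  rw [key, ← integral_neg]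
  congr 1
  ext x
  ring

/-- Resampling one coordinate preserves a product measure. -/
lemma measurePreserving_update {K : Type*} [Fintype K] [DecidableEq K] (μ : Measure ℝ)
    [IsProbabilityMeasure μ] (k : K) :
    MeasurePreserving (fun p : (K → ℝ) × ℝ => Function.update p.1 k p.2)
      ((Measure.pi fun _ => μ).prod μ) (Measure.pi fun _ => μ) := by
  have hm : Measurable fun p : (K → ℝ) × ℝ => Function.update p.1 k p.2 := by
    refine measurable_pi_iff.2 fun j => ?_
    by_cases hj : j = k
    · subst hj; simpa using measurable_snd
    · simpa [Function.update_of_ne hj, Function.comp_def] using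
        (measurable_pi_apply j).comp (measurable_fst (α := K → ℝ) (β := ℝ))
  refine ⟨hm, (Measure.pi_eq fun s hs => ?_).symm⟩
  have hpre : (fun p : (K → ℝ) × ℝ => Function.update p.1 k p.2) ⁻¹' Set.univ.pi s =
      (Set.univ.pi (Function.update s k Set.univ)) ×ˢ s k := by
    ext ⟨g, x⟩
    simp only [Set.mem_preimage, Set.mem_pi, Set.mem_univ, true_implies, Set.mem_prod]
    refine ⟨fun H => ⟨fun j => ?_, by simpa using H k⟩, fun H j => ?_⟩
    · by_cases hj : j = k
      · subst hj; simp
      · simpa [Function.update_of_ne hj] using H j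
    · by_cases hj : j = k
      · subst hj; simpa using H.2
      · simpa [Function.update_of_ne hj] using H.1 j
  rw [Measure.map_apply hm (MeasurableSet.univ_pi hs), hpre, Measure.prod_prod, Measure.pi_pi,
    ← Finset.prod_erase_mul _ _ (Finset.mem_univ k),
    ← Finset.prod_erase_mul _ (fun i => μ (s i)) (Finset.mem_univ k)]
  simp only [Function.update_self, measure_univ, mul_one]
  congr 1
  refine Finset.prod_congr rfl fun j hj => ?_
  rw [Function.update_of_ne (Finset.ne_of_mem_erase hj)]

/-- Gaussian integration by parts for a standard Gaussian vector. -/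
lemma integral_coord_mul_pi_gaussianReal {K : Type*} [Fintype K] [DecidableEq K] (k : K)
    {f f' : (K → ℝ) → ℝ}
    (hd : ∀ g x, HasDerivAt (fun y => f (Function.update g k y)) (f' (Function.update g k x)) x)
    (hf : Integrable f (Measure.pi fun _ : K => gaussianReal 0 1))
    (hxf : Integrable (fun g => g k * f g) (Measure.pi fun _ : K => gaussianReal 0 1))
    (hf' : Integrable f' (Measure.pi fun _ : K => gaussianReal 0 1)) :
    ∫ g, g k * f g ∂(Measure.pi fun _ : K => gaussianReal 0 1) =
      ∫ g, f' g ∂(Measure.pi fun _ : K => gaussianReal 0 1) := by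
  have hU := measurePreserving_update (gaussianReal 0 1) k
  have hint : ∀ F : (K → ℝ) → ℝ, Integrable F (Measure.pi fun _ : K => gaussianReal 0 1) →
      Integrable (fun p : (K → ℝ) × ℝ => F (Function.update p.1 k p.2))
        ((Measure.pi fun _ => gaussianReal 0 1).prod (gaussianReal 0 1)) :=
    fun F hF => hU.integrable_comp_of_integrable hF
  have hdis : ∀ F : (K → ℝ) → ℝ, Integrable F (Measure.pi fun _ : K => gaussianReal 0 1) →
      ∫ g, F g ∂(Measure.pi fun _ : K => gaussianReal 0 1) =
        ∫ g, ∫ x, F (Function.update g k x) ∂gaussianReal 0 1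
          ∂(Measure.pi fun _ : K => gaussianReal 0 1) := by
    intro F hF
    rw [← integral_prod _ (hint F hF)]
    conv_lhs => rw [← hU.map_eq]
    exact integral_map hU.measurable.aemeasurable (hU.map_eq.symm ▸ hF.aestronglyMeasurable)
  rw [hdis _ hxf, hdis _ hf']
  refine integral_congr_ae ?_
  filter_upwards [(hint _ hf).prod_right_ae, (hint _ hxf).prod_right_ae,
    (hint _ hf').prod_right_ae] with g h₁ h₂ h₃
  simp only [Function.update_self] at h₂ ⊢
  exact integral_mul_gaussianReal_eq_integral_deriv (hd g) h₁ h₂ h₃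

section Interpolation

variable {S K : Type*} [Fintype S] [Fintype K]

lemma sum_mul_exp_pos [Nonempty S] {w : S → ℝ} (hw : ∀ σ, 0 < w σ) (L : S → ℝ) :
    0 < ∑ σ, w σ * Real.exp (L σ) :=
  Finset.sum_pos (fun σ _ => mul_pos (hw σ) (Real.exp_pos _)) Finset.univ_nonempty

lemma hasDerivAt_rpow_sum_exp [Nonempty S] {w : S → ℝ} (hw : ∀ σ, 0 < w σ) {L : S → ℝ → ℝ}
    {L' : S → ℝ} {x : ℝ} (hL : ∀ σ, HasDerivAt (L σ) (L' σ) x) (p : ℝ) :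
    HasDerivAt (fun y => (∑ σ, w σ * Real.exp (L σ y)) ^ p)
      (p * (∑ σ, w σ * Real.exp (L σ x)) ^ (p - 1) *
        ∑ σ, w σ * Real.exp (L σ x) * L' σ) x := by
  have h₁ : HasDerivAt (fun y => ∑ σ, w σ * Real.exp (L σ y))
      (∑ σ, w σ * (Real.exp (L σ x) * L' σ)) x :=
    HasDerivAt.fun_sum fun σ _ => ((hL σ).exp).const_mul (w σ)
  convert! h₁.rpow_const (p := p) (Or.inl (sum_mul_exp_pos hw _).ne') using 1
  simp only [mul_assoc]
  ring

lemma abs_linear_le {A : ℝ} {v : K → ℝ} (hv : ∀ k, |v k| ≤ A) (g : K → ℝ) :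
    |∑ k, v k * g k| ≤ A * ∑ k, |g k| := by
  rw [Finset.mul_sum]
  refine (Finset.abs_sum_le_sum_abs _ _).trans (Finset.sum_le_sum fun k _ => ?_)
  rw [abs_mul]
  exact mul_le_mul_of_nonneg_right (hv k) (abs_nonneg _)

lemma HasExpGrowth.exp_linear {Θ : Type*} {A : ℝ} {v : Θ → K → ℝ} (hA : 0 ≤ A)
    (hv : ∀ θ k, |v θ k| ≤ A) :
    HasExpGrowth fun θ (g : K → ℝ) => Real.exp (∑ k, v θ k * g k) := by
  refine ⟨1, A, zero_le_one, hA, fun θ g => ?_⟩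
  rw [abs_of_pos (Real.exp_pos _), one_mul]
  exact Real.exp_le_exp.2 ((le_abs_self _).trans (abs_linear_le (hv θ) g))

lemma HasExpGrowth.rpow_sum_exp [Nonempty S] {Θ : Type*} {w : S → ℝ} (hw : ∀ σ, 0 < w σ)
    {A : ℝ} {v : Θ → S → K → ℝ} (hA : 0 ≤ A) (hv : ∀ θ σ k, |v θ σ k| ≤ A) (p : ℝ) :
    HasExpGrowth fun θ (g : K → ℝ) => (∑ σ, w σ * Real.exp (∑ k, v θ σ k * g k)) ^ p := by
  obtain ⟨σ₀⟩ := ‹Nonempty S›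
  have : Nonempty S := ⟨σ₀⟩
  have hW : 0 < ∑ σ, w σ := Finset.sum_pos (fun σ _ => hw σ) Finset.univ_nonempty
  refine ⟨Real.exp ((|Real.log (w σ₀)| + |Real.log (∑ σ, w σ)|) * |p|), A * |p|,
    (Real.exp_pos _).le, by positivity, fun θ g => ?_⟩
  have hZ := sum_mul_exp_pos hw fun σ => ∑ k, v θ σ k * g k
  have hV := fun σ => abs_le.1 (abs_linear_le (hv θ σ) g)
  have hup : Real.log (∑ σ, w σ * Real.exp (∑ k, v θ σ k * g k)) ≤
      Real.log (∑ σ, w σ) + A * ∑ k, |g k| := by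
    rw [← Real.log_exp (A * ∑ k, |g k|), ← Real.log_mul hW.ne' (Real.exp_pos _).ne',
      Finset.sum_mul]
    refine Real.log_le_log hZ (Finset.sum_le_sum fun σ _ => ?_)
    exact mul_le_mul_of_nonneg_left (Real.exp_le_exp.2 (hV σ).2) (hw σ).le
  have hlow : Real.log (w σ₀) - A * ∑ k, |g k| ≤
      Real.log (∑ σ, w σ * Real.exp (∑ k, v θ σ k * g k)) := by
    rw [sub_eq_add_neg, ← Real.log_exp (-(A * ∑ k, |g k|)),
      ← Real.log_mul (hw σ₀).ne' (Real.exp_pos _).ne']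
    refine Real.log_le_log (mul_pos (hw σ₀) (Real.exp_pos _)) ?_
    refine (mul_le_mul_of_nonneg_left (Real.exp_le_exp.2 (hV σ₀).1) (hw σ₀).le).trans ?_
    exact Finset.single_le_sum (f := fun σ => w σ * Real.exp (∑ k, v θ σ k * g k))
      (fun σ _ => (mul_pos (hw σ) (Real.exp_pos _)).le) (Finset.mem_univ σ₀)
  have hlog : |Real.log (∑ σ, w σ * Real.exp (∑ k, v θ σ k * g k))| ≤
      |Real.log (w σ₀)| + |Real.log (∑ σ, w σ)| + A * ∑ k, |g k| := by
    have h₁ := neg_abs_le (Real.log (w σ₀))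
    have h₂ := le_abs_self (Real.log (∑ σ, w σ))
    have h₃ := abs_nonneg (Real.log (w σ₀))
    have h₄ := abs_nonneg (Real.log (∑ σ, w σ))
    exact abs_le.2 ⟨by linarith, by linarith⟩
  rw [abs_of_pos (Real.rpow_pos_of_pos hZ p), Real.rpow_def_of_pos hZ, ← Real.exp_add]
  refine Real.exp_le_exp.2 ((le_abs_self _).trans ?_)
  rw [abs_mul]
  refine (mul_le_mul_of_nonneg_right hlog (abs_nonneg p)).trans_eq ?_
  ring

lemma continuous_rpow_sum_exp [Nonempty S] {w : S → ℝ} (hw : ∀ σ, 0 < w σ) (v : S → K → ℝ)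
    (p : ℝ) :
    Continuous fun g : K → ℝ => (∑ σ, w σ * Real.exp (∑ k, v σ k * g k)) ^ p :=
  Continuous.rpow_const (by fun_prop) fun _ => Or.inl (sum_mul_exp_pos hw _).ne'

lemma exists_abs_le (v : S → K → ℝ) : ∃ A : ℝ, 0 ≤ A ∧ ∀ σ k, |v σ k| ≤ A := by
  refine ⟨∑ σ, ∑ k, |v σ k|, by positivity, fun σ k => ?_⟩
  exact (Finset.single_le_sum (f := fun k => |v σ k|) (fun _ _ => abs_nonneg _)
    (Finset.mem_univ k)).trans (Finset.single_le_sum (f := fun σ => ∑ k, |v σ k|)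
      (fun _ _ => by positivity) (Finset.mem_univ σ))

lemma integral_rpow_sum_exp_pos [Nonempty S] {w : S → ℝ} (hw : ∀ σ, 0 < w σ) (v : S → K → ℝ)
    (p : ℝ) :
    0 < ∫ g, (∑ σ, w σ * Real.exp (∑ k, v σ k * g k)) ^ p
      ∂(Measure.pi fun _ : K => gaussianReal 0 1) := by
  obtain ⟨A, hA, hv⟩ := exists_abs_le v
  have hpos : ∀ g : K → ℝ, 0 < (∑ σ, w σ * Real.exp (∑ k, v σ k * g k)) ^ p :=
    fun g => Real.rpow_pos_of_pos (sum_mul_exp_pos hw _) p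
  have hint := (HasExpGrowth.rpow_sum_exp (Θ := Unit) hw hA (fun _ => hv) p).integrable
    (fun _ => continuous_rpow_sum_exp hw v p) ()
  rw [integral_pos_iff_support_of_nonneg (fun g => (hpos g).le) hint,
    Function.support_eq_univ fun g => (hpos g).ne']
  simp

/-- Gaussian integration by parts against a Gibbs weight. -/
lemma integral_coord_mul_gibbs [Nonempty S] {w : S → ℝ} (hw : ∀ σ, 0 < w σ) (v : S → K → ℝ)
    (n : ℝ) (σ : S) (k : K) :
    Integrable (fun g : K → ℝ => g k * ((∑ τ, w τ * Real.exp (∑ k, v τ k * g k)) ^ (n - 1) *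
        Real.exp (∑ k, v σ k * g k))) (Measure.pi fun _ : K => gaussianReal 0 1) ∧
    Integrable (fun g : K → ℝ =>
        (n - 1) * (∑ τ, w τ * Real.exp (∑ k, v τ k * g k)) ^ (n - 1 - 1) *
          (∑ τ, w τ * Real.exp (∑ k, v τ k * g k) * v τ k) * Real.exp (∑ k, v σ k * g k) +
        (∑ τ, w τ * Real.exp (∑ k, v τ k * g k)) ^ (n - 1) *
          (Real.exp (∑ k, v σ k * g k) * v σ k)) (Measure.pi fun _ : K => gaussianReal 0 1) ∧
    ∫ g, g k * ((∑ τ, w τ * Real.exp (∑ k, v τ k * g k)) ^ (n - 1) *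
        Real.exp (∑ k, v σ k * g k)) ∂(Measure.pi fun _ : K => gaussianReal 0 1) =
      ∫ g, ((n - 1) * (∑ τ, w τ * Real.exp (∑ k, v τ k * g k)) ^ (n - 1 - 1) *
          (∑ τ, w τ * Real.exp (∑ k, v τ k * g k) * v τ k) * Real.exp (∑ k, v σ k * g k) +
        (∑ τ, w τ * Real.exp (∑ k, v τ k * g k)) ^ (n - 1) *
          (Real.exp (∑ k, v σ k * g k) * v σ k)) ∂(Measure.pi fun _ : K => gaussianReal 0 1) := by
  classical
  obtain ⟨A, hA, hv⟩ := exists_abs_le v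
  have hE : ∀ τ, HasExpGrowth fun (_ : Unit) (g : K → ℝ) => Real.exp (∑ k, v τ k * g k) :=
    fun τ => HasExpGrowth.exp_linear hA fun _ => hv τ
  have hZ : ∀ p : ℝ, HasExpGrowth fun (_ : Unit) (g : K → ℝ) =>
      (∑ τ, w τ * Real.exp (∑ k, v τ k * g k)) ^ p :=
    HasExpGrowth.rpow_sum_exp hw hA fun _ => hv
  have hZc := continuous_rpow_sum_exp hw v
  have hf := (hZ (n - 1)).mul (hE σ)
  have hfc : Continuous fun g : K → ℝ => (∑ τ, w τ * Real.exp (∑ k, v τ k * g k)) ^ (n - 1) *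
      Real.exp (∑ k, v σ k * g k) := (hZc _).mul (by fun_prop)
  have hxf := ((HasExpGrowth.coord k).mul hf).integrable
    (fun _ => (continuous_apply k).mul hfc) ()
  have hf' := ((((HasExpGrowth.const (n - 1)).mul (hZ (n - 1 - 1))).mul
    (HasExpGrowth.sum Finset.univ fun τ =>
      ((HasExpGrowth.const (w τ)).mul (hE τ)).mul (HasExpGrowth.const (v τ k)))).mul (hE σ)).add
    ((hZ (n - 1)).mul ((hE σ).mul (HasExpGrowth.const (v σ k))))
  have hf'i := hf'.integrable (fun _ => (((continuous_const.mul (hZc _)).mul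
    (by fun_prop)).mul (by fun_prop)).add ((hZc _).mul (by fun_prop))) ()
  refine ⟨hxf, hf'i, integral_coord_mul_pi_gaussianReal k (fun g x => ?_)
    (hf.integrable (fun _ => hfc) ()) hxf hf'i⟩
  have hL : ∀ τ, HasDerivAt (fun y => ∑ j, v τ j * Function.update g k y j) (v τ k) x := by
    intro τ
    have h₁ : HasDerivAt (fun y => ∑ j, v τ j * Function.update g k y j)
        (∑ j, v τ j * (Pi.single k 1 : K → ℝ) j) x :=
      HasDerivAt.fun_sum fun j _ => ((hasDerivAt_pi.1 (hasDerivAt_update g k x)) j).const_mul _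
    simpa [Pi.single_apply] using h₁
  exact (hasDerivAt_rpow_sum_exp hw hL (n - 1)).mul (hL σ).exp

lemma gibbs_quadratic_le {m : S → ℝ} (hm : ∀ σ, 0 < m σ) {u v : S → K → ℝ} {n E P : ℝ}
    (hP : 0 ≤ P) (hE : ∀ σ τ, ∑ k, u σ k * v σ k + (n - 1) * ∑ k, u σ k * v τ k ≤ E) :
    ∑ σ, ∑ k, m σ * u σ k * ((n - 1) * P * ∑ τ, m τ * v τ k + P * (∑ τ, m τ) * v σ k) ≤
      P * (∑ σ, m σ) * (∑ σ, m σ) * E := by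
  have h₁ : ∀ σ, ∑ k, m σ * u σ k * ((n - 1) * P * ∑ τ, m τ * v τ k + P * (∑ τ, m τ) * v σ k) =
      ∑ τ, P * m σ * m τ * (∑ k, u σ k * v σ k + (n - 1) * ∑ k, u σ k * v τ k) := by
    intro σ
    simp only [Finset.mul_sum, mul_add, Finset.sum_add_distrib, Finset.sum_mul]
    rw [Finset.sum_comm, add_comm]
    congr 1
    · rw [Finset.sum_comm]
      refine Finset.sum_congr rfl fun τ _ => Finset.sum_congr rfl fun k _ => ?_
      ring
    · refine Finset.sum_congr rfl fun τ _ => Finset.sum_congr rfl fun k _ => ?_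
      ring
  rw [Finset.sum_congr rfl fun σ _ => h₁ σ, mul_assoc P, Finset.sum_mul_sum, mul_assoc P]
  simp only [Finset.sum_mul, Finset.mul_sum]
  refine Finset.sum_le_sum fun σ _ => Finset.sum_le_sum fun τ _ => ?_
  rw [← mul_assoc, ← mul_assoc]
  have := hm σ
  have := hm τ
  simp only [← Finset.mul_sum]
  exact mul_le_mul_of_nonneg_left (hE σ τ) (by positivity)

/-- Gaussian interpolation for fractional moments of a partition function. -/
theorem integral_rpow_sum_exp_le [Nonempty S] {w : S → ℝ} (hw : ∀ σ, 0 < w σ)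
    {a b : S → K → ℝ} (hab : ∀ σ τ k, a σ k * b τ k = 0) {n D : ℝ} (hn : 0 ≤ n)
    (hD : ∀ σ τ, ∑ k, (a σ k * a σ k - b σ k * b σ k) +
      (n - 1) * ∑ k, (a σ k * a τ k - b σ k * b τ k) ≤ D) :
    ∫ g, (∑ σ, w σ * Real.exp (∑ k, a σ k * g k)) ^ n
        ∂(Measure.pi fun _ : K => gaussianReal 0 1) ≤
      Real.exp (n * D / 2) * ∫ g, (∑ σ, w σ * Real.exp (∑ k, b σ k * g k)) ^ n
        ∂(Measure.pi fun _ : K => gaussianReal 0 1) := by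
  set γ := Measure.pi fun _ : K => gaussianReal 0 1 with hγ
  let v : ℝ → S → K → ℝ := fun θ σ k => Real.sin θ * a σ k + Real.cos θ * b σ k
  let u : ℝ → S → K → ℝ := fun θ σ k => Real.cos θ * a σ k - Real.sin θ * b σ k
  let Z : ℝ → (K → ℝ) → ℝ := fun θ g => ∑ σ, w σ * Real.exp (∑ k, v θ σ k * g k)
  obtain ⟨A, hA, hAab'⟩ := exists_abs_le fun σ k => |a σ k| + |b σ k|
  have hAab : ∀ σ k, |a σ k| + |b σ k| ≤ A := fun σ k => (le_abs_self _).trans (hAab' σ k)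
  have hrot : ∀ s c x y : ℝ, |s| ≤ 1 → |c| ≤ 1 → |s * x| + |c * y| ≤ |x| + |y| := by
    intro s c x y hs hc
    rw [abs_mul, abs_mul]
    exact add_le_add (mul_le_of_le_one_left (abs_nonneg _) hs)
      (mul_le_of_le_one_left (abs_nonneg _) hc)
  have hv : ∀ θ σ k, |v θ σ k| ≤ A := fun θ σ k => (abs_add_le _ _).trans
    ((hrot _ _ _ _ (Real.abs_sin_le_one θ) (Real.abs_cos_le_one θ)).trans (hAab σ k))
  have hu : ∀ θ σ k, |u θ σ k| ≤ A := fun θ σ k => (abs_sub _ _).trans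
    ((hrot _ _ _ _ (Real.abs_cos_le_one θ) (Real.abs_sin_le_one θ)).trans (hAab σ k))
  have hZpos : ∀ θ g, 0 < Z θ g := fun θ g => sum_mul_exp_pos hw _
  have hZg : ∀ p : ℝ, HasExpGrowth fun θ g => Z θ g ^ p :=
    HasExpGrowth.rpow_sum_exp hw hA hv
  have hZc : ∀ (p : ℝ) θ, Continuous fun g => Z θ g ^ p :=
    fun p θ => continuous_rpow_sum_exp hw (v θ) p
  have hEg : ∀ σ, HasExpGrowth fun θ (g : K → ℝ) => Real.exp (∑ k, v θ σ k * g k) :=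
    fun σ => HasExpGrowth.exp_linear hA fun θ => hv θ σ
  let G : ℝ → (K → ℝ) → ℝ := fun θ g => n * Z θ g ^ (n - 1) *
    ∑ σ, w σ * Real.exp (∑ k, v θ σ k * g k) * ∑ k, u θ σ k * g k
  have hGg : HasExpGrowth G := ((HasExpGrowth.const n).mul (hZg (n - 1))).mul
    (HasExpGrowth.sum Finset.univ fun σ => ((HasExpGrowth.const (w σ)).mul (hEg σ)).mul
      (HasExpGrowth.sum Finset.univ fun k =>
        (HasExpGrowth.of_bounded fun θ => hu θ σ k).mul (HasExpGrowth.coord k)))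
  have hGc : ∀ θ, Continuous (G θ) := fun θ =>
    (continuous_const.mul (hZc _ θ)).mul (by fun_prop)
  have hvd : ∀ θ σ k, HasDerivAt (fun t => v t σ k) (u θ σ k) θ := by
    intro θ σ k
    have := ((Real.hasDerivAt_sin θ).mul_const (a σ k)).add
      ((Real.hasDerivAt_cos θ).mul_const (b σ k))
    convert! this using 1
    simp only [u]
    ring
  have hderiv : ∀ θ, HasDerivAt (fun t => ∫ g, Z t g ^ n ∂γ) (∫ g, G θ g ∂γ) θ := by
    intro θ
    obtain ⟨C, B, hC, hB, hbound⟩ := id hGg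
    have hbi : Integrable (fun g : K → ℝ => C * Real.exp (B * ∑ k, |g k|)) γ := by
      refine HasExpGrowth.integrable (Θ := Unit)
        (f := fun _ (g : K → ℝ) => C * Real.exp (B * ∑ k, |g k|)) ⟨C, B, hC, hB, fun _ g => ?_⟩
        (fun _ => by fun_prop) ()
      rw [abs_of_nonneg (by positivity)]
    exact (hasDerivAt_integral_of_dominated_loc_of_deriv_le (s := Set.univ) Filter.univ_mem
      (Eventually.of_forall fun t => (hZc n t).aestronglyMeasurable)
      ((hZg n).integrable (hZc n) θ) (hGc θ).aestronglyMeasurable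
      (ae_of_all _ fun g t _ => hbound t g) hbi
      (ae_of_all _ fun g t _ => hasDerivAt_rpow_sum_exp hw
        (fun σ => HasDerivAt.fun_sum fun k _ => (hvd t σ k).mul_const (g k)) n)).2
  have huv : ∀ θ σ τ, ∑ k, u θ σ k * v θ τ k =
      Real.sin θ * Real.cos θ * ∑ k, (a σ k * a τ k - b σ k * b τ k) := by
    intro θ σ τ
    rw [Finset.mul_sum]
    refine Finset.sum_congr rfl fun k _ => ?_
    have h₁ := hab σ τ k
    have h₂ := hab τ σ k
    simp only [u, v]
    linear_combination Real.cos θ ^ 2 * h₁ - Real.sin θ ^ 2 * h₂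
  have hGle : ∀ θ, 0 ≤ Real.sin θ * Real.cos θ →
      ∫ g, G θ g ∂γ ≤ n * (Real.sin θ * Real.cos θ * D) * ∫ g, Z θ g ^ n ∂γ := by
    intro θ hθ
    have ibp := fun σ k => integral_coord_mul_gibbs hw (v θ) n σ k
    have hG : ∀ g, G θ g = ∑ σ, ∑ k, n * (w σ * u θ σ k) *
        (g k * (Z θ g ^ (n - 1) * Real.exp (∑ k, v θ σ k * g k))) := by
      intro g
      simp only [G, Finset.mul_sum]
      refine Finset.sum_congr rfl fun σ _ => Finset.sum_congr rfl fun k _ => ?_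
      ring
    simp only [hG]
    rw [integral_finsetSum _ fun σ _ => integrable_finsetSum _ fun k _ =>
      (ibp σ k).1.const_mul _]
    have hrw : ∀ σ, ∫ g, ∑ k, n * (w σ * u θ σ k) *
        (g k * (Z θ g ^ (n - 1) * Real.exp (∑ k, v θ σ k * g k))) ∂γ =
        ∫ g, ∑ k, n * (w σ * u θ σ k) * ((n - 1) * Z θ g ^ (n - 1 - 1) *
          (∑ τ, w τ * Real.exp (∑ k, v θ τ k * g k) * v θ τ k) * Real.exp (∑ k, v θ σ k * g k) +
          Z θ g ^ (n - 1) * (Real.exp (∑ k, v θ σ k * g k) * v θ σ k)) ∂γ := by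
      intro σ
      rw [integral_finsetSum _ fun k _ => (ibp σ k).1.const_mul _,
        integral_finsetSum _ fun k _ => (ibp σ k).2.1.const_mul _]
      refine Finset.sum_congr rfl fun k _ => ?_
      rw [integral_const_mul, integral_const_mul]
      exact congrArg _ (ibp σ k).2.2
    rw [Finset.sum_congr rfl fun σ _ => hrw σ,
      ← integral_finsetSum _ fun σ _ => integrable_finsetSum _ fun k _ =>
        (ibp σ k).2.1.const_mul _, ← integral_const_mul]
    refine integral_mono (integrable_finsetSum _ fun σ _ => integrable_finsetSum _ fun k _ =>
        (ibp σ k).2.1.const_mul _) (((hZg n).integrable (hZc n) θ).const_mul _) fun g => ?_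
    have hpow₁ : Z θ g ^ (n - 1) = Z θ g ^ (n - 1 - 1) * Z θ g := by
      rw [Real.rpow_sub_one (hZpos θ g).ne' (n - 1), div_mul_cancel₀ _ (hZpos θ g).ne']
    have hpow : Z θ g ^ n = Z θ g ^ (n - 1 - 1) * Z θ g * Z θ g := by
      rw [← hpow₁, Real.rpow_sub_one (hZpos θ g).ne' n, div_mul_cancel₀ _ (hZpos θ g).ne']
    have key := gibbs_quadratic_le (m := fun σ => w σ * Real.exp (∑ k, v θ σ k * g k))
      (fun σ => mul_pos (hw σ) (Real.exp_pos _)) (u := u θ) (v := v θ) (n := n)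
      (E := Real.sin θ * Real.cos θ * D) (P := Z θ g ^ (n - 1 - 1))
      (Real.rpow_nonneg (hZpos θ g).le _) (fun σ τ => by
        rw [huv, huv]
        have := mul_le_mul_of_nonneg_left (hD σ τ) hθ
        linarith)
    have key' := mul_le_mul_of_nonneg_left key hn
    simp only
    rw [hpow, hpow₁]
    refine le_trans (le_of_eq ?_) (key'.trans_eq ?_)
    · refine Eq.trans ?_ (Finset.mul_sum _ _ _).symm
      refine Finset.sum_congr rfl fun σ _ => Eq.trans ?_ (Finset.mul_sum _ _ _).symm
      refine Finset.sum_congr rfl fun k _ => ?_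
      simp only [Z]
      ring
    · simp only [Z]
      ring
  have hanti : AntitoneOn (fun θ => (∫ g, Z θ g ^ n ∂γ) * Real.exp (-(n * D / 2) * Real.sin θ ^ 2))
      (Set.Icc 0 (π / 2)) := by
    have hd : ∀ θ, HasDerivAt
        (fun θ => (∫ g, Z θ g ^ n ∂γ) * Real.exp (-(n * D / 2) * Real.sin θ ^ 2))
        ((∫ g, G θ g ∂γ) * Real.exp (-(n * D / 2) * Real.sin θ ^ 2) +
          (∫ g, Z θ g ^ n ∂γ) * (Real.exp (-(n * D / 2) * Real.sin θ ^ 2) *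
            (-(n * D / 2) * (2 * Real.sin θ * Real.cos θ)))) θ := by
      intro θ
      refine (hderiv θ).mul (HasDerivAt.exp (HasDerivAt.const_mul _ ?_))
      simpa using! (Real.hasDerivAt_sin θ).pow 2
    refine antitoneOn_of_deriv_nonpos (convex_Icc _ _)
      (fun θ _ => (hd θ).continuousAt.continuousWithinAt)
      (fun θ _ => (hd θ).differentiableAt.differentiableWithinAt) fun θ hθ => ?_
    rw [interior_Icc] at hθ
    have hsc : 0 ≤ Real.sin θ * Real.cos θ :=
      mul_nonneg (Real.sin_nonneg_of_nonneg_of_le_pi hθ.1.le (by linarith [hθ.2, Real.pi_pos]))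
        (Real.cos_nonneg_of_neg_pi_div_two_le_of_le (by linarith [hθ.1, Real.pi_pos]) hθ.2.le)
    rw [(hd θ).deriv]
    have := mul_le_mul_of_nonneg_right (hGle θ hsc)
      (Real.exp_pos (-(n * D / 2) * Real.sin θ ^ 2)).le
    linarith
  have hfin := hanti (Set.left_mem_Icc.2 (by positivity)) (Set.right_mem_Icc.2 (by positivity))
    (by positivity : (0 : ℝ) ≤ π / 2)
  simp only [Z, v, Real.sin_zero, Real.cos_zero, Real.sin_pi_div_two, Real.cos_pi_div_two,
    zero_mul, one_mul, zero_add, add_zero, one_pow, mul_one, ne_eq, OfNat.ofNat_ne_zero,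
    not_false_eq_true, zero_pow, mul_zero, Real.exp_zero] at hfin
  have := mul_le_mul_of_nonneg_left hfin (Real.exp_pos (n * D / 2)).le
  rwa [mul_left_comm, ← Real.exp_add, add_neg_cancel, Real.exp_zero, mul_one] at this

end Interpolation

lemma integral_pi_sum_comp_inl {ι κ : Type*} [Fintype ι] [Fintype κ] (μ : Measure ℝ)
    [IsProbabilityMeasure μ] {F : (ι → ℝ) → ℝ} (hF : Continuous F) :
    ∫ g : ι ⊕ κ → ℝ, F (fun i => g (Sum.inl i)) ∂(Measure.pi fun _ => μ) =
      ∫ g, F g ∂(Measure.pi fun _ => μ) := by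
  have h := measurePreserving_fst.comp
    (measurePreserving_sumPiEquivProdPi (fun _ : ι ⊕ κ => μ))
  rw [← h.map_eq, integral_map h.measurable.aemeasurable hF.aestronglyMeasurable]
  rfl

lemma integral_pi_sum_comp_inr {ι κ : Type*} [Fintype ι] [Fintype κ] (μ : Measure ℝ)
    [IsProbabilityMeasure μ] {F : (κ → ℝ) → ℝ} (hF : Continuous F) :
    ∫ g : ι ⊕ κ → ℝ, F (fun i => g (Sum.inr i)) ∂(Measure.pi fun _ => μ) =
      ∫ g, F g ∂(Measure.pi fun _ => μ) := by
  have h := measurePreserving_snd.comp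
    (measurePreserving_sumPiEquivProdPi (fun _ : ι ⊕ κ => μ))
  rw [← h.map_eq, integral_map h.measurable.aemeasurable hF.aestronglyMeasurable]
  rfl

lemma spinVal_mul_self (b : Bool) : spinVal b * spinVal b = 1 := by
  cases b <;> simp [spinVal]

lemma sum_ite_lt_mul (N : ℕ) (x : Fin N → ℝ) :
    ∑ p : Fin N × Fin N, (if p.1 < p.2 then x p.1 * x p.2 else 0) =
      ((∑ i, x i) ^ 2 - ∑ i, x i * x i) / 2 := by
  have h₁ : (∑ i, x i) ^ 2 = ∑ p : Fin N × Fin N, x p.1 * x p.2 := by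
    rw [sq, Finset.sum_mul_sum, Fintype.sum_prod_type]
  have h₂ : ∑ i, x i * x i =
      ∑ p : Fin N × Fin N, (if p.1 = p.2 then x p.1 * x p.2 else 0) := by
    rw [Fintype.sum_prod_type]
    simp
  have h₃ : ∑ p : Fin N × Fin N, (if p.2 < p.1 then x p.1 * x p.2 else 0) =
      ∑ p : Fin N × Fin N, (if p.1 < p.2 then x p.1 * x p.2 else 0) := by
    rw [← (Equiv.prodComm (Fin N) (Fin N)).sum_comp]
    refine Finset.sum_congr rfl fun p _ => ?_
    simp [mul_comm]
  have h₄ : ∑ p : Fin N × Fin N, x p.1 * x p.2 =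
      ∑ p : Fin N × Fin N, (if p.1 < p.2 then x p.1 * x p.2 else 0) +
      ∑ p : Fin N × Fin N, (if p.1 = p.2 then x p.1 * x p.2 else 0) +
      ∑ p : Fin N × Fin N, (if p.2 < p.1 then x p.1 * x p.2 else 0) := by
    rw [← Finset.sum_add_distrib, ← Finset.sum_add_distrib]
    refine Finset.sum_congr rfl fun p _ => ?_
    rcases lt_trichotomy p.1 p.2 with h | h | h
    · simp [h, h.ne, h.not_gt]
    · simp [h]
    · simp [h, h.ne', h.not_gt]
  linarith

/-- The noninteracting partition function factorizes over the sites. -/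
lemma sum_exp_spinVal (N : ℕ) (y : Fin N → ℝ) :
    ∑ σ : Fin N → Bool, Real.exp (∑ i, y i * spinVal (σ i)) = ∏ i, (2 * Real.cosh (y i)) := by
  simp_rw [Real.exp_sum]
  rw [← Fintype.prod_sum fun i b => Real.exp (y i * spinVal b)]
  refine Finset.prod_congr rfl fun i _ => ?_
  rw [Fintype.sum_bool, Real.cosh_eq]
  simp [spinVal]
  ring

lemma skZ_eq_sum (N : ℕ) (β h : ℝ) (J : Fin N × Fin N → ℝ) :
    skZ N β h J = ∑ σ : Fin N → Bool, Real.exp (β * h * ∑ i, spinVal (σ i)) *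
      Real.exp (∑ p : Fin N × Fin N, (if p.1 < p.2 then
        β / √(N : ℝ) * (spinVal (σ p.1) * spinVal (σ p.2)) else 0) * J p) := by
  refine Finset.sum_congr rfl fun σ _ => ?_
  rw [← Real.exp_add, skH, Finset.sum_filter]
  congr 1
  have : ∑ p : Fin N × Fin N, (if p.1 < p.2 then
        β / √(N : ℝ) * (spinVal (σ p.1) * spinVal (σ p.2)) else 0) * J p =
      β / √(N : ℝ) * ∑ p : Fin N × Fin N,
        (if p.1 < p.2 then J p * spinVal (σ p.1) * spinVal (σ p.2) else 0) := by
    rw [Finset.mul_sum]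
    refine Finset.sum_congr rfl fun p _ => ?_
    split_ifs <;> ring
  rw [this]
  ring

lemma integral_rpow_noninteracting (N : ℕ) {n : ℝ} (β h s : ℝ) :
    ∫ z : Fin N → ℝ, (∑ σ : Fin N → Bool, Real.exp (β * h * ∑ i, spinVal (σ i)) *
      Real.exp (∑ i, β * s * spinVal (σ i) * z i)) ^ n
        ∂(Measure.pi fun _ => gaussianReal 0 1) =
      (2 ^ n * ∫ z, Real.cosh (β * (s * z + h)) ^ n ∂gaussianReal 0 1) ^ N := by
  have h₁ : ∀ z : Fin N → ℝ, (∑ σ : Fin N → Bool, Real.exp (β * h * ∑ i, spinVal (σ i)) *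
      Real.exp (∑ i, β * s * spinVal (σ i) * z i)) ^ n =
      ∏ i, (2 ^ n * Real.cosh (β * (s * z i + h)) ^ n) := by
    intro z
    rw [Finset.prod_congr rfl fun i _ =>
        (Real.mul_rpow zero_le_two (Real.cosh_pos (β * (s * z i + h))).le).symm,
      Real.finsetProd_rpow _ _ fun i _ => by positivity, ← sum_exp_spinVal]
    congr 1
    refine Finset.sum_congr rfl fun σ _ => ?_
    rw [← Real.exp_add, Finset.mul_sum, ← Finset.sum_add_distrib]
    congr 1
    refine Finset.sum_congr rfl fun i _ => ?_
    ring
  simp_rw [h₁]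
  rw [integral_fintype_prod_eq_pow fun z : ℝ => 2 ^ n * Real.cosh (β * (s * z + h)) ^ n,
    integral_const_mul, Fintype.card_fin]

/-- Fractional moments of the SK partition function are bounded by those of the noninteracting
system in a Gaussian field of variance `q`. -/
lemma integral_skZ_rpow_le {N : ℕ} (hN : 1 ≤ N) {n β h q : ℝ} (hn₀ : 0 ≤ n) (hn₁ : n ≤ 1)
    (hq : 0 ≤ q) :
    ∫ J, skZ N β h J ^ n ∂skMuJ N ≤
      Real.exp (n * (β ^ 2 * N / 2 * (1 - 2 * q - (n - 1) * q ^ 2)) / 2) *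
        (2 ^ n * ∫ z, Real.cosh (β * (√q * z + h)) ^ n ∂gaussianReal 0 1) ^ N := by
  have hN₀ : (0 : ℝ) < N := by exact_mod_cast hN
  let w : (Fin N → Bool) → ℝ := fun σ => Real.exp (β * h * ∑ i, spinVal (σ i))
  have hw : ∀ σ, 0 < w σ := fun σ => Real.exp_pos _
  let c : (Fin N → Bool) → Fin N × Fin N → ℝ := fun σ p =>
    if p.1 < p.2 then β / √(N : ℝ) * (spinVal (σ p.1) * spinVal (σ p.2)) else 0
  let d : (Fin N → Bool) → Fin N → ℝ := fun σ i => β * √q * spinVal (σ i)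
  have hcov : ∀ σ τ : Fin N → Bool, ∑ p, c σ p * c τ p - ∑ i, d σ i * d τ i =
      β ^ 2 / N * (((∑ i, spinVal (σ i) * spinVal (τ i)) ^ 2 - N) / 2) -
        β ^ 2 * q * ∑ i, spinVal (σ i) * spinVal (τ i) := by
    intro σ τ
    congr 1
    · have h₁ := sum_ite_lt_mul N fun i => spinVal (σ i) * spinVal (τ i)
      have h₂ : ∀ i, spinVal (σ i) * spinVal (τ i) * (spinVal (σ i) * spinVal (τ i)) = 1 := by
        intro i
        rw [mul_mul_mul_comm, spinVal_mul_self, spinVal_mul_self, one_mul]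
      simp only [h₂, Finset.sum_const, Finset.card_univ, Fintype.card_fin, nsmul_eq_mul,
        mul_one] at h₁
      rw [← h₁, Finset.mul_sum]
      refine Finset.sum_congr rfl fun p _ => ?_
      simp only [c]
      split_ifs
      · rw [mul_mul_mul_comm, div_mul_div_comm, Real.mul_self_sqrt hN₀.le]
        ring
      · simp
    · rw [Finset.mul_sum]
      refine Finset.sum_congr rfl fun i _ => ?_
      have : √q * √q = q := Real.mul_self_sqrt hq
      simp only [d]
      linear_combination β ^ 2 * (spinVal (σ i) * spinVal (τ i)) * this
  let a : (Fin N → Bool) → (Fin N × Fin N) ⊕ Fin N → ℝ := fun σ => Sum.elim (c σ) 0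
  let b : (Fin N → Bool) → (Fin N × Fin N) ⊕ Fin N → ℝ := fun σ => Sum.elim 0 (d σ)
  have hsplit : ∀ σ τ, ∑ k, (a σ k * a τ k - b σ k * b τ k) =
      ∑ p, c σ p * c τ p - ∑ i, d σ i * d τ i := by
    intro σ τ
    simp [a, b, Fintype.sum_sum_type, sub_eq_add_neg]
  have main := integral_rpow_sum_exp_le hw (a := a) (b := b)
    (fun σ τ k => by cases k <;> simp [a, b]) hn₀
    (D := β ^ 2 * N / 2 * (1 - 2 * q - (n - 1) * q ^ 2)) (fun σ τ => by
      rw [hsplit, hsplit, hcov, hcov]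
      simp only [spinVal_mul_self, Finset.sum_const, Finset.card_univ, Fintype.card_fin,
        nsmul_eq_mul, mul_one]
      set m := ∑ i, spinVal (σ i) * spinVal (τ i)
      have h₁ : 0 ≤ (1 - n) * (β ^ 2 / (2 * N) * (m - q * N) ^ 2) :=
        mul_nonneg (by linarith) (by positivity)
      have h₂ : 0 ≤ n * β ^ 2 / 2 := by positivity
      rw [← sub_nonneg]
      refine (add_nonneg h₁ h₂).trans_eq ?_
      field_simp
      ring)
  simp only [a, b, Fintype.sum_sum_type, Sum.elim_inl, Sum.elim_inr, Pi.zero_apply, zero_mul,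
    Finset.sum_const_zero, add_zero, zero_add] at main
  rw [integral_pi_sum_comp_inl (κ := Fin N) (gaussianReal 0 1)
      (continuous_rpow_sum_exp hw c n),
    integral_pi_sum_comp_inr (ι := Fin N × Fin N) (gaussianReal 0 1)
      (continuous_rpow_sum_exp hw d n), integral_rpow_noninteracting] at main
  simp only [skZ_eq_sum]
  exact main

/-- `φ_N(n,β,h) ≤ α_RS(n,β,h)` uniformly in `N`. -/
theorem stmt9 (n β h : ℝ) (hn : n ∈ Set.Ioc (0:ℝ) 1) (hβ : 0 < β) :
    ∀ N : ℕ, 1 ≤ N → skPhi N n β h ≤ alphaRS n β h := by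
  intro N hN
  obtain ⟨hn₀, hn₁⟩ := hn
  have hN₀ : (0 : ℝ) < N := by exact_mod_cast hN
  refine le_ciInf fun ⟨q, hq⟩ => ?_
  have hle := integral_skZ_rpow_le (β := β) (h := h) hN hn₀.le hn₁ hq.1
  have hpos : 0 < ∫ J, skZ N β h J ^ n ∂skMuJ N := by
    simp only [skZ_eq_sum]
    exact integral_rpow_sum_exp_pos (fun _ => Real.exp_pos _) _ n
  unfold skPhi rsTrial
  set I := ∫ z, Real.cosh (β * (√q * z + h)) ^ n ∂gaussianReal 0 1
  have hI : I ≠ 0 := by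
    intro hI
    rw [hI, mul_zero, zero_pow (by lia), mul_zero] at hle
    exact hpos.not_ge hle
  have h₂ : (2 : ℝ) ^ n ≠ 0 := (Real.rpow_pos_of_pos two_pos n).ne'
  have hlog := Real.log_le_log hpos hle
  rw [Real.log_mul (Real.exp_pos _).ne' (pow_ne_zero _ (mul_ne_zero h₂ hI)), Real.log_exp,
    Real.log_pow, Real.log_mul h₂ hI, Real.log_rpow two_pos] at hlog
  refine (mul_le_mul_of_nonneg_left hlog (by positivity)).trans_eq ?_
  field_simp
  ring
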